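/- arXiv:1602.01418 — 3 statements merged into one kernel-verified Lean document; each statement's English description precedes it below -/
import Mathlib

section
/- Let N ≥ 2 with N = 2n or N = 2n+1, index the standard basis of ℂ^N by I_N = {-n,…,-1,1,…,n} (including 0 when N is odd), and set θ_{ij} = 1 for all i,j (orthogonal case). Let P = Σ_{i,j∈I_N} E_{ij}⊗E_{ji}, Q = Σ_{i,j∈I_N} θ_{ij} E_{ij}⊗E_{-i,-j} ∈ End(ℂ^N⊗ℂ^N), κ = N/2 − 1, and R(u) = I − P/u + Q/(u−κ). Then for all u,v ∈ ℂ with u, v, u+v ∉ {0, κ}, the quantum Yang–Baxter equation with spectral parameters holds on (ℂ^N)^{⊗3}: R₁₂(u) R₁₃(u+v) R₂₃(v) = R₂₃(v) R₁₃(u+v) R₁₂(u), where R_{ab}(u) acts as R(u) on tensor factors a and b and as the identity on the remaining factor. -/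
open Matrix Kronecker Finset

noncomputable section

/-- The index set `I_N` as a subtype of `ℤ` determined by a finite set `S ⊆ ℤ`. -/
abbrev Idx (S : Finset ℤ) : Type := {i : ℤ // i ∈ S}

/-- The matrix unit `E_{ab}` of `End(ℂ^N)` (zero if `a` or `b` is not in the index set). -/
def Emat (S : Finset ℤ) (a b : ℤ) : Matrix (Idx S) (Idx S) ℂ :=
  fun p q => if ((p : ℤ) = a ∧ (q : ℤ) = b) then 1 else 0

/-- The permutation operator `P = Σ_{i,j} E_{ij} ⊗ E_{ji}` on `ℂ^N ⊗ ℂ^N`. -/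
def Pmat (S : Finset ℤ) : Matrix (Idx S × Idx S) (Idx S × Idx S) ℂ :=
  ∑ i ∈ S, ∑ j ∈ S, Emat S i j ⊗ₖ Emat S j i

/-- The operator `Q = Σ_{i,j} θ_{ij} E_{ij} ⊗ E_{-i,-j}` on `ℂ^N ⊗ ℂ^N`. -/
def Qmat (S : Finset ℤ) (θ : ℤ → ℤ → ℂ) : Matrix (Idx S × Idx S) (Idx S × Idx S) ℂ :=
  ∑ i ∈ S, ∑ j ∈ S, θ i j • (Emat S i j ⊗ₖ Emat S (-i) (-j))

/-- The R-matrix `R(u) = I - P/u + Q/(u - κ)` of types B, C, D. -/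
def Rmat (S : Finset ℤ) (θ : ℤ → ℤ → ℂ) (κ u : ℂ) :
    Matrix (Idx S × Idx S) (Idx S × Idx S) ℂ :=
  1 - u⁻¹ • Pmat S + (u - κ)⁻¹ • Qmat S θ

/-- `θ_{ij} = 1` (orthogonal case). -/
def θorth : ℤ → ℤ → ℂ := fun _ _ => 1

/-- `θ_{ij} = sign(i)·sign(j)` (symplectic case). -/
def θsymp : ℤ → ℤ → ℂ := fun i j =>
  (if 0 < i then (1 : ℂ) else -1) * (if 0 < j then (1 : ℂ) else -1)

/-- `R_{12}`: act on tensor factors 1 and 2 of the triple tensor product. -/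
def lift12 (S : Finset ℤ) (M : Matrix (Idx S × Idx S) (Idx S × Idx S) ℂ) :
    Matrix (Idx S × Idx S × Idx S) (Idx S × Idx S × Idx S) ℂ :=
  fun p q => M (p.1, p.2.1) (q.1, q.2.1) * (if p.2.2 = q.2.2 then 1 else 0)

/-- `R_{13}`: act on tensor factors 1 and 3 of the triple tensor product. -/
def lift13 (S : Finset ℤ) (M : Matrix (Idx S × Idx S) (Idx S × Idx S) ℂ) :
    Matrix (Idx S × Idx S × Idx S) (Idx S × Idx S × Idx S) ℂ :=
  fun p q => M (p.1, p.2.2) (q.1, q.2.2) * (if p.2.1 = q.2.1 then 1 else 0)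

/-- `R_{23}`: act on tensor factors 2 and 3 of the triple tensor product. -/
def lift23 (S : Finset ℤ) (M : Matrix (Idx S × Idx S) (Idx S × Idx S) ℂ) :
    Matrix (Idx S × Idx S × Idx S) (Idx S × Idx S × Idx S) ℂ :=
  fun p q => M (p.2.1, p.2.2) (q.2.1, q.2.2) * (if p.1 = q.1 then 1 else 0)

/-- The negation `i ↦ -i` on an index set closed under negation. -/
def negIdx {S : Finset ℤ} (hS : ∀ i ∈ S, -i ∈ S) (i : Idx S) : Idx S := ⟨-i, hS i i.2⟩

lemma negIdx_negIdx {S : Finset ℤ} (hS : ∀ i ∈ S, -i ∈ S) (i : Idx S) :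
    negIdx hS (negIdx hS i) = i := by
  simp [negIdx]

lemma Pmat_apply (S : Finset ℤ) (p q : Idx S × Idx S) :
    Pmat S p q = if p.2 = q.1 ∧ p.1 = q.2 then 1 else 0 := by
  obtain ⟨⟨a, ha⟩, ⟨b, hb⟩⟩ := p
  obtain ⟨⟨c, hc⟩, ⟨d, hd⟩⟩ := q
  simp only [Pmat, Matrix.sum_apply, kroneckerMap_apply, Emat, Subtype.mk.injEq]
  rw [Finset.sum_eq_single_of_mem a ha, Finset.sum_eq_single_of_mem c hc]
  · by_cases h1 : b = c <;> by_cases h2 : a = d <;> simp [h1, h2, eq_comm]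
  · intro j _ hj
    simp [hj.symm]
  · intro i _ hi
    simp [hi.symm]

lemma Qmat_θorth_apply {S : Finset ℤ} (hS : ∀ i ∈ S, -i ∈ S) (p q : Idx S × Idx S) :
    Qmat S θorth p q = if p.2 = negIdx hS p.1 ∧ q.2 = negIdx hS q.1 then 1 else 0 := by
  obtain ⟨⟨a, ha⟩, ⟨b, hb⟩⟩ := p
  obtain ⟨⟨c, hc⟩, ⟨d, hd⟩⟩ := q
  simp only [Qmat, θorth, one_smul, Matrix.sum_apply, kroneckerMap_apply, Emat, negIdx,
    Subtype.mk.injEq]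
  rw [Finset.sum_eq_single_of_mem a ha, Finset.sum_eq_single_of_mem c hc]
  · simp
  · intro j _ hj
    simp [hj.symm]
  · intro i _ hi
    simp [hi.symm]

section Lifts

variable (S : Finset ℤ)

lemma lift12_Rmat (θ : ℤ → ℤ → ℂ) (κ u : ℂ) : lift12 S (Rmat S θ κ u) =
    1 - u⁻¹ • lift12 S (Pmat S) + (u - κ)⁻¹ • lift12 S (Qmat S θ) := by
  ext ⟨a, b, c⟩ ⟨a', b', c'⟩
  by_cases h : c = c' <;> simp [lift12, Rmat, Matrix.one_apply, h]

lemma lift13_Rmat (θ : ℤ → ℤ → ℂ) (κ u : ℂ) : lift13 S (Rmat S θ κ u) =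
    1 - u⁻¹ • lift13 S (Pmat S) + (u - κ)⁻¹ • lift13 S (Qmat S θ) := by
  ext ⟨a, b, c⟩ ⟨a', b', c'⟩
  by_cases h : b = b' <;> simp [lift13, Rmat, Matrix.one_apply, h]

lemma lift23_Rmat (θ : ℤ → ℤ → ℂ) (κ u : ℂ) : lift23 S (Rmat S θ κ u) =
    1 - u⁻¹ • lift23 S (Pmat S) + (u - κ)⁻¹ • lift23 S (Qmat S θ) := by
  ext ⟨a, b, c⟩ ⟨a', b', c'⟩
  by_cases h : a = a' <;> simp [lift23, Rmat, Matrix.one_apply, h]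

variable {S} (M : Matrix (Idx S × Idx S × Idx S) (Idx S × Idx S × Idx S) ℂ)
  (p q : Idx S × Idx S × Idx S)

lemma lift12_Pmat_mul_apply :
    (lift12 S (Pmat S) * M) p q = M (p.2.1, p.1, p.2.2) q := by
  rw [Matrix.mul_apply, Finset.sum_eq_single (p.2.1, p.1, p.2.2)]
  · simp [lift12, Pmat_apply]
  · rintro ⟨a, b, c⟩ - h
    simp only [lift12, Pmat_apply]
    grind
  · simp

lemma mul_lift12_Pmat_apply :
    (M * lift12 S (Pmat S)) p q = M p (q.2.1, q.1, q.2.2) := by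
  rw [Matrix.mul_apply, Finset.sum_eq_single (q.2.1, q.1, q.2.2)]
  · simp [lift12, Pmat_apply]
  · rintro ⟨a, b, c⟩ - h
    simp only [lift12, Pmat_apply]
    grind
  · simp

lemma lift13_Pmat_mul_apply :
    (lift13 S (Pmat S) * M) p q = M (p.2.2, p.2.1, p.1) q := by
  rw [Matrix.mul_apply, Finset.sum_eq_single (p.2.2, p.2.1, p.1)]
  · simp [lift13, Pmat_apply]
  · rintro ⟨a, b, c⟩ - h
    simp only [lift13, Pmat_apply]
    grind
  · simp

lemma mul_lift13_Pmat_apply :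
    (M * lift13 S (Pmat S)) p q = M p (q.2.2, q.2.1, q.1) := by
  rw [Matrix.mul_apply, Finset.sum_eq_single (q.2.2, q.2.1, q.1)]
  · simp [lift13, Pmat_apply]
  · rintro ⟨a, b, c⟩ - h
    simp only [lift13, Pmat_apply]
    grind
  · simp

lemma lift23_Pmat_mul_apply :
    (lift23 S (Pmat S) * M) p q = M (p.1, p.2.2, p.2.1) q := by
  rw [Matrix.mul_apply, Finset.sum_eq_single (p.1, p.2.2, p.2.1)]
  · simp [lift23, Pmat_apply]
  · rintro ⟨a, b, c⟩ - h
    simp only [lift23, Pmat_apply]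
    grind
  · simp

lemma mul_lift23_Pmat_apply :
    (M * lift23 S (Pmat S)) p q = M p (q.1, q.2.2, q.2.1) := by
  rw [Matrix.mul_apply, Finset.sum_eq_single (q.1, q.2.2, q.2.1)]
  · simp [lift23, Pmat_apply]
  · rintro ⟨a, b, c⟩ - h
    simp only [lift23, Pmat_apply]
    grind
  · simp

lemma lift12_Qmat_mul_apply (hS : ∀ i ∈ S, -i ∈ S) :
    (lift12 S (Qmat S θorth) * M) p q =
      if p.2.1 = negIdx hS p.1 then ∑ k, M (k, negIdx hS k, p.2.2) q else 0 := by
  simp only [Matrix.mul_apply, Fintype.sum_prod_type, lift12, Qmat_θorth_apply hS]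
  split_ifs with h <;> simp [h]

end Lifts

/-- The Yang–Baxter equation in an algebra generated by elements satisfying the relations of the
Brauer algebra on three strands with loop parameter `N = 2 (κ + 1)`. The transposition of strands
`1` and `3` and the corresponding contractions are obtained by conjugation. -/
theorem yang_baxter_of_brauer {A : Type*} [Ring A] [Algebra ℂ A] {N κ u v : ℂ}
    {P₁₂ P₁₃ P₂₃ Q₁₂ Q₁₃ Q₂₃ : A}
    (hP₁₂ : P₁₂ * P₁₂ = 1) (hP₂₃ : P₂₃ * P₂₃ = 1)
    (hP₁₃ : P₁₃ = P₁₂ * P₂₃ * P₁₂) (hP₁₃' : P₁₃ = P₂₃ * P₁₂ * P₂₃)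
    (hQ₁₃ : Q₁₃ = P₂₃ * Q₁₂ * P₂₃) (hQ₂₃ : Q₂₃ = P₁₃ * Q₁₂ * P₁₃)
    (hPQ : P₁₂ * Q₁₂ = Q₁₂) (hQP : Q₁₂ * P₁₂ = Q₁₂)
    (hQQ : Q₁₂ * Q₁₂ = N • Q₁₂) (hQPQ : Q₁₂ * P₂₃ * Q₁₂ = Q₁₂)
    (hκ : κ = N / 2 - 1)
    (hu0 : u ≠ 0) (huκ : u ≠ κ) (hv0 : v ≠ 0) (hvκ : v ≠ κ)
    (huv0 : u + v ≠ 0) (huvκ : u + v ≠ κ) :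
    (1 - u⁻¹ • P₁₂ + (u - κ)⁻¹ • Q₁₂) * (1 - (u + v)⁻¹ • P₁₃ + (u + v - κ)⁻¹ • Q₁₃) *
        (1 - v⁻¹ • P₂₃ + (v - κ)⁻¹ • Q₂₃) =
      (1 - v⁻¹ • P₂₃ + (v - κ)⁻¹ • Q₂₃) * (1 - (u + v)⁻¹ • P₁₃ + (u + v - κ)⁻¹ • Q₁₃) *
        (1 - u⁻¹ • P₁₂ + (u - κ)⁻¹ • Q₁₂) := by
  have hbraid : P₂₃ * (P₁₂ * P₂₃) = P₁₂ * (P₂₃ * P₁₂) := by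
    rw [← mul_assoc, ← mul_assoc, ← hP₁₃, ← hP₁₃']
  replace hQPQ : Q₁₂ * (P₂₃ * Q₁₂) = Q₁₂ := by rw [← mul_assoc, hQPQ]
  have hP₁₂' (x : A) : P₁₂ * (P₁₂ * x) = x := by rw [← mul_assoc, hP₁₂, one_mul]
  have hP₂₃' (x : A) : P₂₃ * (P₂₃ * x) = x := by rw [← mul_assoc, hP₂₃, one_mul]
  have hbraid' (x : A) : P₂₃ * (P₁₂ * (P₂₃ * x)) = P₁₂ * (P₂₃ * (P₁₂ * x)) := by
    simpa only [mul_assoc] using congr($hbraid * x)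
  have hPQ' (x : A) : P₁₂ * (Q₁₂ * x) = Q₁₂ * x := by rw [← mul_assoc, hPQ]
  have hQP' (x : A) : Q₁₂ * (P₁₂ * x) = Q₁₂ * x := by rw [← mul_assoc, hQP]
  have hQQ' (x : A) : Q₁₂ * (Q₁₂ * x) = N • (Q₁₂ * x) := by rw [← mul_assoc, hQQ, smul_mul_assoc]
  have hQPQ' (x : A) : Q₁₂ * (P₂₃ * (Q₁₂ * x)) = Q₁₂ * x := by
    simpa only [mul_assoc] using congr($hQPQ * x)
  have huκ' := sub_ne_zero.2 huκ
  have hvκ' := sub_ne_zero.2 hvκ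
  have huvκ' := sub_ne_zero.2 huvκ
  obtain rfl : N = 2 * (κ + 1) := by rw [hκ]; ring
  rw [hQ₂₃, hQ₁₃, hP₁₃]
  simp only [mul_add, add_mul, mul_sub, sub_mul, mul_one, one_mul, smul_mul_assoc,
    mul_smul_comm, smul_smul, mul_assoc, smul_add, smul_sub, hP₁₂, hP₁₂', hP₂₃, hP₂₃', hbraid,
    hbraid', hPQ, hPQ', hQP, hQP', hQQ, hQQ', hQPQ, hQPQ']
  match_scalars <;> field_simp <;> ring

lemma neg_mem_symm_Icc {N n : ℕ} {S : Finset ℤ}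
    (hS : S = if N = 2 * n then (Finset.Icc (-(n : ℤ)) (n : ℤ)).erase 0
              else Finset.Icc (-(n : ℤ)) (n : ℤ)) : ∀ i ∈ S, -i ∈ S := by
  subst hS
  intro i hi
  split_ifs at hi ⊢ <;> simp only [Finset.mem_erase, Finset.mem_Icc] at hi ⊢ <;> omega

lemma card_symm_Icc {N n : ℕ} (hpar : N = 2 * n ∨ N = 2 * n + 1) {S : Finset ℤ}
    (hS : S = if N = 2 * n then (Finset.Icc (-(n : ℤ)) (n : ℤ)).erase 0
              else Finset.Icc (-(n : ℤ)) (n : ℤ)) : S.card = N := by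
  subst hS
  split_ifs
  · rw [Finset.card_erase_of_mem (by simp), Int.card_Icc]
    omega
  · rw [Int.card_Icc]
    omega

/-- the quantum Yang–Baxter equation for the orthogonal R-matrix
`R(u) = I - P/u + Q/(u-κ)`, `κ = N/2 - 1`, with index set `{-n,…,-1,(0),1,…,n}`. -/
theorem yang_baxter_orthogonal (N n : ℕ) (hN : 2 ≤ N) (hpar : N = 2 * n ∨ N = 2 * n + 1)
    (S : Finset ℤ)
    (hS : S = if N = 2 * n then (Finset.Icc (-(n : ℤ)) (n : ℤ)).erase 0
              else Finset.Icc (-(n : ℤ)) (n : ℤ))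
    (κ : ℂ) (hκ : κ = (N : ℂ) / 2 - 1)
    (u v : ℂ) (hu0 : u ≠ 0) (huκ : u ≠ κ) (hv0 : v ≠ 0) (hvκ : v ≠ κ)
    (huv0 : u + v ≠ 0) (huvκ : u + v ≠ κ) :
    lift12 S (Rmat S θorth κ u) * lift13 S (Rmat S θorth κ (u + v)) *
        lift23 S (Rmat S θorth κ v) =
      lift23 S (Rmat S θorth κ v) * lift13 S (Rmat S θorth κ (u + v)) *
        lift12 S (Rmat S θorth κ u) := by
  have hneg := neg_mem_symm_Icc hS
  rw [lift12_Rmat, lift13_Rmat, lift23_Rmat]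
  refine yang_baxter_of_brauer ?_ ?_ ?_ ?_ ?_ ?_ ?_ ?_ ?_ ?_ hκ hu0 huκ hv0 hvκ huv0 huvκ
  · ext p q
    rw [lift12_Pmat_mul_apply]
    simp only [lift12, Pmat_apply, Matrix.one_apply]
    grind
  · ext p q
    rw [lift23_Pmat_mul_apply]
    simp only [lift23, Pmat_apply, Matrix.one_apply]
    grind
  · ext p q
    rw [mul_lift12_Pmat_apply, lift12_Pmat_mul_apply]
    simp only [lift13, lift23, Pmat_apply]
  · ext p q
    rw [mul_lift23_Pmat_apply, lift23_Pmat_mul_apply]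
    simp only [lift13, lift12, Pmat_apply]
  · ext p q
    rw [mul_lift23_Pmat_apply, lift23_Pmat_mul_apply]
    simp only [lift13, lift12]
  · ext p q
    rw [mul_lift13_Pmat_apply, lift13_Pmat_mul_apply]
    simp only [lift23, lift12, Qmat_θorth_apply hneg]
    grind [negIdx_negIdx]
  · ext p q
    rw [lift12_Pmat_mul_apply]
    simp only [lift12, Qmat_θorth_apply hneg]
    grind [negIdx_negIdx]
  · ext p q
    rw [mul_lift12_Pmat_apply]
    simp only [lift12, Qmat_θorth_apply hneg]
    grind [negIdx_negIdx]
  · ext p q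
    rw [lift12_Qmat_mul_apply _ _ _ hneg, ← card_symm_Icc hpar hS]
    simp only [lift12, Qmat_θorth_apply hneg, Matrix.smul_apply]
    split_ifs <;> simp_all
  · ext p q
    rw [mul_assoc, lift12_Qmat_mul_apply _ _ _ hneg]
    simp only [lift23_Pmat_mul_apply]
    simp only [lift12, Qmat_θorth_apply hneg]
    rw [Finset.sum_eq_single (negIdx hneg p.2.2)]
    · grind [negIdx_negIdx]
    · grind [negIdx_negIdx]
    · simp
end
end

section
/- Let N = 2n ≥ 2 with indices I_N = {-n,…,-1,1,…,n}, θ_{ij} = sign(i)·sign(j), P = Σ E_{ij}⊗E_{ji}, Q = Σ θ_{ij} E_{ij}⊗E_{-i,-j}, κ = N/2 + 1, and R(u) = I − P/u + Q/(u−κ) (the symplectic R-matrix). Let 𝒢 = Σ_{i=1}^{n} (E_{ii} − E_{-i,-i}) (the matrix of the symmetric pair of type CI, (sp_N, gl_{N/2})). Then the constant K-matrix K(u) = 𝒢 is a solution of the reflection equation: for all u,v ∈ ℂ with u−v, u+v ∉ {0, κ}, R(u−v) 𝒢₁ R(u+v) 𝒢₂ = 𝒢₂ R(u+v) 𝒢₁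 R(u−v) in End(ℂ^N⊗ℂ^N), where 𝒢₁ = 𝒢⊗I and 𝒢₂ = I⊗𝒢. -/
open Matrix Kronecker Finset

noncomputable section

/-- The matrix relations that force the reflection equation, in an arbitrary `ℂ`-algebra. -/
theorem reflection_of_relations {M : Type*} [Ring M] [Algebra ℂ M] {P Q A B : M}
    (hAA : A * A = 1) (hBB : B * B = 1) (hAB : A * B = B * A) (hPP : P * P = 1)
    (hPA : P * A = B * P) (hPB : P * B = A * P) (hPQ : P * Q = -Q) (hQP : Q * P = -Q)
    (hBQ : B * Q = -(A * Q)) (hQB : Q * B = -(Q * A)) (a b c d : ℂ) :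
    (1 - a • P + c • Q) * A * (1 - b • P + d • Q) * B =
      B * (1 - b • P + d • Q) * A * (1 - a • P + c • Q) := by
  have hQAQ : Q * A * Q = 0 := by
    have h : Q * A * Q = -(Q * A * Q) := by
      calc Q * A * Q = -(Q * P) * A * -(P * Q) := by rw [hPQ, hQP, neg_neg]
        _ = Q * (P * A) * (P * Q) := by noncomm_ring
        _ = Q * B * (P * P) * Q := by rw [hPA]; noncomm_ring
        _ = -(Q * A * Q) := by rw [hPP, hQB]; noncomm_ring
    have h2 : (2 : ℂ) • (Q * A * Q) = 0 := by
      rw [two_smul]; nth_rewrite 1 [h]; exact neg_add_cancel _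
    exact (smul_eq_zero_iff_right two_ne_zero).mp h2
  have e1 : P * A * B = B * A * P := by rw [hPA, mul_assoc, hPB, mul_assoc]
  have e2 : A * P * B = B * P * A := by
    rw [mul_assoc, hPB, mul_assoc B, hPA, ← mul_assoc, ← mul_assoc, hAA, hBB]
  have e3 : Q * A * B = B * A * Q := by
    rw [mul_assoc, hAB, ← mul_assoc, hQB, ← hAB, mul_assoc A, hBQ, neg_mul, mul_neg, mul_assoc Q,
      ← mul_assoc A, hAA, mul_one, one_mul]
  have e4 : A * Q * B = B * Q * A := by
    rw [mul_assoc, hQB, hBQ, mul_neg, neg_mul, mul_assoc]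
  have e5 : P * A * P * B = B * P * A * P := by
    rw [mul_assoc (P * A), hPB, mul_assoc P, ← mul_assoc A, hAA, one_mul, hPP, mul_assoc B, hPA,
      ← mul_assoc, hBB, one_mul, hPP]
  have e6 : P * A * Q * B = B * Q * A * P := by
    rw [hPA, mul_assoc B, hPQ, mul_assoc (B * Q), ← hPB, ← mul_assoc, mul_assoc B Q P, hQP]
  have e7 : Q * A * P * B = B * P * A * Q := by
    rw [mul_assoc (Q * A), hPB, mul_assoc Q, ← mul_assoc A, hAA, one_mul, hQP, mul_assoc B, hPA,
      ← mul_assoc, hBB, one_mul, hPQ]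
  have e8 : Q * A * Q * B = B * Q * A * Q := by
    rw [hQAQ, mul_assoc B, mul_assoc B, hQAQ, zero_mul, mul_zero]
  simp only [add_mul, sub_mul, mul_add, mul_sub, smul_mul_assoc, mul_smul_comm, one_mul, mul_one,
    smul_add, smul_sub, e1, e2, e3, e4, e5, e6, e7, e8, hAB, smul_comm b a, smul_comm b c,
    smul_comm d a, smul_comm d c]
  abel

theorem Pmat_eq_submatrix (S : Finset ℤ) :
    Pmat S = (1 : Matrix (Idx S × Idx S) (Idx S × Idx S) ℂ).submatrix Prod.swap id := by
  ext ⟨⟨p, hp⟩, ⟨p', hp'⟩⟩ ⟨⟨q, hq⟩, ⟨q', hq'⟩⟩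
  rw [Pmat, Matrix.sum_apply, Finset.sum_eq_single_of_mem p hp, Matrix.sum_apply,
    Finset.sum_eq_single_of_mem q hq]
  · simp [Emat, Matrix.one_apply, eq_comm, and_comm]
  · intro j _ hj
    simp [Emat, hj.symm]
  · intro i _ hi
    simp [Emat, Matrix.sum_apply, hi.symm]

/-- The vector `w = Σ sign(i) e_i ⊗ e_{-i}`, for which `Q = w wᵀ` in the symplectic case. -/
def symplecticVec (S : Finset ℤ) : Idx S × Idx S → ℂ := fun p =>
  if (p.2 : ℤ) = -p.1 then (if 0 < (p.1 : ℤ) then 1 else -1) else 0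

theorem Qmat_eq_vecMulVec (S : Finset ℤ) :
    Qmat S θsymp = Matrix.vecMulVec (symplecticVec S) (symplecticVec S) := by
  ext ⟨⟨p, hp⟩, ⟨p', hp'⟩⟩ ⟨⟨q, hq⟩, ⟨q', hq'⟩⟩
  rw [Qmat, Matrix.sum_apply, Finset.sum_eq_single_of_mem p hp, Matrix.sum_apply,
    Finset.sum_eq_single_of_mem q hq]
  · simp only [Emat, Matrix.smul_apply, Matrix.kroneckerMap_apply, smul_eq_mul,
      Matrix.vecMulVec_apply, symplecticVec, θsymp]
    grind
  · intro j _ hj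
    simp [Emat, hj.symm]
  · intro i _ hi
    simp [Emat, Matrix.sum_apply, hi.symm]

theorem symplecticVec_swap {S : Finset ℤ} (h0 : (0 : ℤ) ∉ S) (p : Idx S × Idx S) :
    symplecticVec S p.swap = -symplecticVec S p := by
  obtain ⟨⟨p, hp⟩, ⟨p', hp'⟩⟩ := p
  have : p ≠ 0 := fun h => h0 (h ▸ hp)
  simp only [symplecticVec, Prod.swap_prod_mk]
  grind

theorem Pmat_mul_apply (S : Finset ℤ) (M : Matrix (Idx S × Idx S) (Idx S × Idx S) ℂ)
    (p q : Idx S × Idx S) : (Pmat S * M) p q = M p.swap q := by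
  simp [Pmat_eq_submatrix, Matrix.mul_apply, Matrix.one_apply]

theorem mul_Pmat_apply (S : Finset ℤ) (M : Matrix (Idx S × Idx S) (Idx S × Idx S) ℂ)
    (p q : Idx S × Idx S) : (M * Pmat S) p q = M p q.swap := by
  simp [Pmat_eq_submatrix, Matrix.mul_apply, Matrix.one_apply, Prod.swap_eq_iff_eq_swap]

/-- The matrix of type CI is diagonal with the signs of the indices as entries. -/
theorem sum_Emat_sub_eq_diagonal (n : ℕ) {S : Finset ℤ}
    (hS : S = (Finset.Icc (-(n : ℤ)) (n : ℤ)).erase 0) :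
    ∑ i ∈ Finset.Icc (1 : ℤ) (n : ℤ), (Emat S i i - Emat S (-i) (-i)) =
      Matrix.diagonal fun p : Idx S => if 0 < (p : ℤ) then (1 : ℂ) else -1 := by
  ext ⟨p, hp⟩ ⟨q, hq⟩
  have hp' : p ≠ 0 ∧ -(n : ℤ) ≤ p ∧ p ≤ n := by simpa [hS] using hp
  have hneg (i : ℤ) : p = -i ↔ -p = i := by omega
  simp only [Emat, Matrix.sum_apply, Matrix.sub_apply, Matrix.diagonal_apply,
    Finset.sum_sub_distrib, ite_and, hneg, Finset.sum_ite_eq, Finset.mem_Icc, Subtype.mk.injEq]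
  grind

/-- the constant K-matrix `K(u) = 𝒢 = Σ_{i=1}^{n} (E_{ii} - E_{-i,-i})`
of type CI solves the reflection equation for the symplectic R-matrix (`κ = N/2 + 1`). -/
theorem reflection_CI (N n : ℕ) (hN : 2 ≤ N) (hpar : N = 2 * n)
    (S : Finset ℤ) (hS : S = (Finset.Icc (-(n : ℤ)) (n : ℤ)).erase 0)
    (κ : ℂ) (hκ : κ = (N : ℂ) / 2 + 1)
    (G : Matrix (Idx S) (Idx S) ℂ)
    (hG : G = ∑ i ∈ Finset.Icc (1 : ℤ) (n : ℤ), (Emat S i i - Emat S (-i) (-i)))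
    (u v : ℂ) (h1 : u - v ≠ 0) (h2 : u - v ≠ κ) (h3 : u + v ≠ 0) (h4 : u + v ≠ κ) :
    Rmat S θsymp κ (u - v) * (G ⊗ₖ (1 : Matrix (Idx S) (Idx S) ℂ)) *
        Rmat S θsymp κ (u + v) * ((1 : Matrix (Idx S) (Idx S) ℂ) ⊗ₖ G) =
      ((1 : Matrix (Idx S) (Idx S) ℂ) ⊗ₖ G) * Rmat S θsymp κ (u + v) *
        (G ⊗ₖ (1 : Matrix (Idx S) (Idx S) ℂ)) * Rmat S θsymp κ (u - v) := by
  rw [sum_Emat_sub_eq_diagonal n hS] at hG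
  have h0 : (0 : ℤ) ∉ S := by simp [hS]
  have hA : G ⊗ₖ (1 : Matrix (Idx S) (Idx S) ℂ) =
      Matrix.diagonal fun p => if 0 < (p.1 : ℤ) then (1 : ℂ) else -1 := by
    rw [hG, ← Matrix.diagonal_one, Matrix.diagonal_kronecker_diagonal]; simp
  have hB : (1 : Matrix (Idx S) (Idx S) ℂ) ⊗ₖ G =
      Matrix.diagonal fun p => if 0 < (p.2 : ℤ) then (1 : ℂ) else -1 := by
    rw [hG, ← Matrix.diagonal_one, Matrix.diagonal_kronecker_diagonal]; simp
  have hw (p : Idx S × Idx S) : (if 0 < (p.2 : ℤ) then (1 : ℂ) else -1) * symplecticVec S p =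
      -((if 0 < (p.1 : ℤ) then (1 : ℂ) else -1) * symplecticVec S p) := by
    obtain ⟨⟨p, hp⟩, ⟨p', hp'⟩⟩ := p
    have : p ≠ 0 := fun h => h0 (h ▸ hp)
    simp only [symplecticVec]
    grind
  rw [hA, hB]
  apply reflection_of_relations
  · rw [Matrix.diagonal_mul_diagonal, ← Matrix.diagonal_one]
    congr 1; ext p; split_ifs <;> norm_num
  · rw [Matrix.diagonal_mul_diagonal, ← Matrix.diagonal_one]
    congr 1; ext p; split_ifs <;> norm_num
  · simp only [Matrix.diagonal_mul_diagonal, mul_comm]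
  · ext p q
    rw [Pmat_mul_apply, Pmat_eq_submatrix, Matrix.submatrix_apply, Prod.swap_swap, id]
  · ext p q
    rw [Pmat_mul_apply, mul_Pmat_apply]
    simp only [Matrix.diagonal_apply, Prod.swap_eq_iff_eq_swap, Prod.fst_swap]
  · ext p q
    rw [Pmat_mul_apply, mul_Pmat_apply]
    simp only [Matrix.diagonal_apply, Prod.swap_eq_iff_eq_swap, Prod.snd_swap]
  · ext p q
    rw [Pmat_mul_apply, Qmat_eq_vecMulVec]
    simp [Matrix.vecMulVec_apply, symplecticVec_swap h0]
  · ext p q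
    rw [mul_Pmat_apply, Qmat_eq_vecMulVec]
    simp [Matrix.vecMulVec_apply, symplecticVec_swap h0]
  · ext p q
    rw [Matrix.neg_apply, Matrix.diagonal_mul, Matrix.diagonal_mul, Qmat_eq_vecMulVec,
      Matrix.vecMulVec_apply, ← mul_assoc, hw, neg_mul, mul_assoc]
  · ext p q
    rw [Matrix.neg_apply, Matrix.mul_diagonal, Matrix.mul_diagonal, Qmat_eq_vecMulVec,
      Matrix.vecMulVec_apply, mul_assoc, mul_comm (symplecticVec S q), hw, mul_neg]
    ring
end
end

section
/- Let p, q be positive even integers with p > q, set N = p + q = 2n, and use indices I_N = {-n,…,-1,1,…,n}, θ_{ij} = sign(i)·sign(j), P = Σ E_{ij}⊗E_{ji}, Q = Σ θ_{ij} E_{ij}⊗E_{-i,-j}, κ = N/2 + 1, R(u) = I − P/u + Q/(u−κ) (the symplectic R-matrix). Let 𝒢 = −Σ_{i=1}^{q/2}(E_{ii}+E_{-i,-i}) + Σ_{i=q/2+1}^{N/2}(E_{ii}+E_{-i,-i}) (the matrix of the symmetric pair of type CII, (sp_N, sp_p ⊕ sp_q)), c = 4/(p−q), and K(u) = (I − cu𝒢)(1−cu)^{−1}.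 Then K(u) is a solution of the reflection equation: as an identity of rational functions in u,v, R(u−v) K₁(u) R(u+v) K₂(v) = K₂(v) R(u+v) K₁(u) R(u−v) in End(ℂ^N⊗ℂ^N), where K₁(u) = K(u)⊗I and K₂(v) = I⊗K(v). -/
open Matrix Kronecker Finset

noncomputable section

/-- The K-matrix `K(u) = (I - c·u·𝒢)(1 - c·u)⁻¹`. -/
def Kmat (S : Finset ℤ) (c : ℂ) (G : Matrix (Idx S) (Idx S) ℂ) (u : ℂ) :
    Matrix (Idx S) (Idx S) ℂ :=
  (1 - c * u)⁻¹ • ((1 : Matrix (Idx S) (Idx S) ℂ) - (c * u) • G)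

/-- The reflection equation in an algebra generated by elements `P`, `Q`, `a`, `b` subject to the
relations satisfied by the operators `P`, `Q`, `𝒢 ⊗ I`, `I ⊗ 𝒢` in the symplectic case. -/
theorem reflection_of_relations_s5 {A : Type*} [Ring A] [Algebra ℂ A] {P Q a b : A} {N t : ℂ}
    (hPP : P * P = 1) (hPQ : P * Q = -Q) (hQP : Q * P = -Q) (hQQ : Q * Q = N • Q)
    (haa : a * a = 1) (hbb : b * b = 1) (hba : b * a = a * b)
    (hPa : P * a = b * P) (hPb : P * b = a * P) (hbQ : b * Q = a * Q) (hQb : Q * b = Q * a)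
    (hQaQ : Q * a * Q = t • Q) (ht : t ≠ 0) {κ c : ℂ} (hκ : κ = N / 2 + 1) (hc : c = 4 / t)
    {u v : ℂ} (h1 : u - v ≠ 0) (h2 : u - v ≠ κ) (h3 : u + v ≠ 0) (h4 : u + v ≠ κ) :
    (1 - (u - v)⁻¹ • P + (u - v - κ)⁻¹ • Q) * (1 - (c * u) • a) *
        (1 - (u + v)⁻¹ • P + (u + v - κ)⁻¹ • Q) * (1 - (c * v) • b) =
      (1 - (c * v) • b) * (1 - (u + v)⁻¹ • P + (u + v - κ)⁻¹ • Q) *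
        (1 - (c * u) • a) * (1 - (u - v)⁻¹ • P + (u - v - κ)⁻¹ • Q) := by
  have reassoc {x y z : A} (h : x * y = z) (r : A) : x * (y * r) = z * r := by
    rw [← mul_assoc, h]
  have hQaQ' : Q * (a * Q) = t • Q := by rw [← mul_assoc, hQaQ]
  have hQaP : Q * (a * P) = -(Q * a) := by rw [← hPb, reassoc hQP, neg_mul, hQb]
  have hQab : Q * (a * b) = Q := by rw [← hba, reassoc hQb, mul_assoc, haa, mul_one]
  have hd : u - v - κ ≠ 0 := sub_ne_zero.2 h2
  have he : u + v - κ ≠ 0 := sub_ne_zero.2 h4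
  have hN : N = 2 * (κ - 1) := by rw [hκ]; ring
  clear hκ
  simp only [mul_add, add_mul, mul_sub, sub_mul, smul_mul_assoc, mul_smul_comm, mul_one, one_mul,
    mul_assoc, hPP, hPQ, hQP, hQQ, hbb, hba, hPa, hPb, hbQ, hQb, hQaQ', hQaP, hQab,
    reassoc haa, reassoc hbb, reassoc hba, neg_mul, mul_neg]
  match_scalars <;> subst hN hc <;> field_simp <;> ring

/-- The sign of a nonzero integer, as a complex number. -/
def csign (i : ℤ) : ℂ := if 0 < i then 1 else -1

theorem csign_mul_self (i : ℤ) : csign i * csign i = 1 := by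
  unfold csign; split_ifs <;> simp

theorem csign_neg {i : ℤ} (hi : i ≠ 0) : csign (-i) = -csign i := by
  unfold csign
  split_ifs <;> first | omega | simp

/-- The vector `Σ_i sign(i) e_i ⊗ e_{-i}` spanning the image of `Q`. -/
def qVec (S : Finset ℤ) : Idx S × Idx S → ℂ :=
  fun x => if (x.2 : ℤ) = -(x.1 : ℤ) then csign x.1 else 0

theorem Pmat_eq (S : Finset ℤ) : Pmat S = (1 : Matrix _ _ ℂ).submatrix (Equiv.prodComm _ _) id := by
  ext ⟨⟨a, ha⟩, ⟨b, hb⟩⟩ ⟨⟨d, hd⟩, ⟨e, he⟩⟩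
  simp only [Pmat, Matrix.sum_apply, kroneckerMap_apply, Emat, submatrix_apply, one_apply,
    Equiv.prodComm_apply, Prod.swap, id, Prod.mk.injEq, Subtype.mk.injEq]
  rw [Finset.sum_eq_single_of_mem a ha, Finset.sum_eq_single_of_mem d hd]
  · by_cases h : b = d <;> by_cases h' : a = e <;> simp [h, h', eq_comm]
  · intro j _ hj; simp [hj.symm]
  · intro i _ hi; simp [hi.symm]

theorem Qmat_eq (S : Finset ℤ) : Qmat S θsymp = vecMulVec (qVec S) (qVec S) := by
  ext ⟨⟨a, ha⟩, ⟨b, hb⟩⟩ ⟨⟨d, hd⟩, ⟨e, he⟩⟩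
  simp only [Qmat, Matrix.sum_apply, Matrix.smul_apply, kroneckerMap_apply, Emat, vecMulVec_apply,
    qVec]
  rw [Finset.sum_eq_single_of_mem a ha, Finset.sum_eq_single_of_mem d hd]
  · by_cases h : b = -a <;> by_cases h' : e = -d <;> simp [h, h', θsymp, csign]
  · intro j _ hj; simp [hj.symm]
  · intro i _ hi; simp [hi.symm]

theorem Pmat_mul (S : Finset ℤ) (M : Matrix (Idx S × Idx S) (Idx S × Idx S) ℂ) :
    Pmat S * M = M.submatrix Prod.swap id := by
  rw [Pmat_eq]
  exact one_submatrix_mul (Equiv.prodComm _ _) (Equiv.refl _) M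

theorem mul_Pmat (S : Finset ℤ) (M : Matrix (Idx S × Idx S) (Idx S × Idx S) ℂ) :
    M * Pmat S = M.submatrix id Prod.swap := by
  rw [Pmat_eq]
  exact mul_submatrix_one (Equiv.prodComm _ _) id M

theorem Pmat_mul_self (S : Finset ℤ) : Pmat S * Pmat S = 1 := by
  rw [Pmat_mul, Pmat_eq, submatrix_submatrix]
  ext x y
  simp [one_apply]

theorem Pmat_mul_kronecker_one (S : Finset ℤ) (M : Matrix (Idx S) (Idx S) ℂ) :
    Pmat S * (M ⊗ₖ 1) = (1 ⊗ₖ M) * Pmat S := by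
  rw [Pmat_mul, mul_Pmat]
  ext ⟨a, b⟩ ⟨d, e⟩
  simp [mul_comm]

theorem Pmat_mul_one_kronecker (S : Finset ℤ) (M : Matrix (Idx S) (Idx S) ℂ) :
    Pmat S * (1 ⊗ₖ M) = (M ⊗ₖ 1) * Pmat S := by
  rw [Pmat_mul, mul_Pmat]
  ext ⟨a, b⟩ ⟨d, e⟩
  simp [mul_comm]

theorem qVec_swap {S : Finset ℤ} (h0 : (0 : ℤ) ∉ S) (x : Idx S × Idx S) :
    qVec S x.swap = -qVec S x := by
  obtain ⟨⟨a, ha⟩, ⟨b, hb⟩⟩ := x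
  have ha0 : a ≠ 0 := fun h => h0 (h ▸ ha)
  simp only [qVec, Prod.swap]
  by_cases h : b = -a
  · rw [if_pos h, if_pos (by omega), h, csign_neg ha0]
  · rw [if_neg h, if_neg (by omega), neg_zero]

theorem Pmat_mul_Qmat {S : Finset ℤ} (h0 : (0 : ℤ) ∉ S) :
    Pmat S * Qmat S θsymp = -Qmat S θsymp := by
  rw [Pmat_mul, Qmat_eq]
  ext x y
  simp [vecMulVec_apply, qVec_swap h0]

theorem Qmat_mul_Pmat {S : Finset ℤ} (h0 : (0 : ℤ) ∉ S) :
    Qmat S θsymp * Pmat S = -Qmat S θsymp := by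
  rw [mul_Pmat, Qmat_eq]
  ext x y
  simp [vecMulVec_apply, qVec_swap h0]

theorem one_kronecker_diagonal_mul_Qmat {S : Finset ℤ} {g : ℤ → ℂ} (hg : ∀ i, g (-i) = g i) :
    (1 ⊗ₖ diagonal fun i : Idx S => g i) * Qmat S θsymp =
      ((diagonal fun i : Idx S => g i) ⊗ₖ 1) * Qmat S θsymp := by
  rw [Qmat_eq, ← diagonal_one, diagonal_kronecker_diagonal, diagonal_kronecker_diagonal]
  ext x y
  by_cases h : (x.2 : ℤ) = -(x.1 : ℤ) <;> simp [diagonal_mul, vecMulVec_apply, qVec, h, hg]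

theorem Qmat_mul_one_kronecker_diagonal {S : Finset ℤ} {g : ℤ → ℂ} (hg : ∀ i, g (-i) = g i) :
    Qmat S θsymp * (1 ⊗ₖ diagonal fun i : Idx S => g i) =
      Qmat S θsymp * ((diagonal fun i : Idx S => g i) ⊗ₖ 1) := by
  rw [Qmat_eq, ← diagonal_one, diagonal_kronecker_diagonal, diagonal_kronecker_diagonal]
  ext x y
  by_cases h : (y.2 : ℤ) = -(y.1 : ℤ) <;> simp [mul_diagonal, vecMulVec_apply, qVec, h, hg]

theorem Qmat_mul_diagonal_kronecker_one_mul_Qmat {S : Finset ℤ} (hneg : ∀ i ∈ S, -i ∈ S)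
    (g : Idx S → ℂ) :
    Qmat S θsymp * (diagonal g ⊗ₖ 1) * Qmat S θsymp = (diagonal g).trace • Qmat S θsymp := by
  have key : qVec S ᵥ* (diagonal g ⊗ₖ 1) ⬝ᵥ qVec S = (diagonal g).trace := by
    rw [← diagonal_one, diagonal_kronecker_diagonal, trace_diagonal]
    simp only [dotProduct, vecMul_diagonal, mul_one, Fintype.sum_prod_type]
    refine Finset.sum_congr rfl fun i _ => ?_
    rw [Finset.sum_eq_single ⟨-i, hneg i i.2⟩]
    · simp only [qVec, if_true]
      rw [mul_right_comm, csign_mul_self, one_mul]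
    · intro j _ hj
      have : (j : ℤ) ≠ -(i : ℤ) := fun h => hj (Subtype.ext h)
      simp [qVec, this]
    · simp
  rw [Qmat_eq, vecMulVec_mul, vecMulVec_mul_vecMulVec, key]
  ext x y
  simp only [vecMulVec_apply, Matrix.smul_apply, Pi.smul_apply, smul_eq_mul]
  ring

theorem Qmat_mul_self {S : Finset ℤ} (hneg : ∀ i ∈ S, -i ∈ S) :
    Qmat S θsymp * Qmat S θsymp = (#S : ℂ) • Qmat S θsymp := by
  simpa [trace_diagonal] using Qmat_mul_diagonal_kronecker_one_mul_Qmat hneg (fun _ => 1)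

theorem Emat_self_apply (S : Finset ℤ) (i : ℤ) (x y : Idx S) :
    Emat S i i x y = if x = y ∧ (x : ℤ) = i then 1 else 0 := by
  unfold Emat
  congr 1
  simp only [Subtype.ext_iff, eq_iff_iff]
  omega

theorem trace_Emat_self {S : Finset ℤ} {i : ℤ} (hi : i ∈ S) : (Emat S i i).trace = 1 := by
  rw [Matrix.trace, Finset.sum_eq_single ⟨i, hi⟩]
  · simp [Emat]
  · intro j _ hj
    have : (j : ℤ) ≠ i := fun h => hj (Subtype.ext h)
    simp [Emat, this]
  · simp

theorem sum_Emat_pair (S : Finset ℤ) {a : ℤ} (ha : 0 < a) (b : ℤ) :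
    ∑ i ∈ Finset.Icc a b, (Emat S i i + Emat S (-i) (-i)) =
      diagonal fun x : Idx S => if a ≤ |(x : ℤ)| ∧ |(x : ℤ)| ≤ b then 1 else 0 := by
  ext x y
  by_cases hxy : x = y
  · subst hxy
    simp only [Matrix.sum_apply, Matrix.add_apply, Emat_self_apply, true_and, diagonal_apply_eq]
    have (i : ℤ) (hi : i ∈ Finset.Icc a b) :
        ((if (x : ℤ) = i then 1 else 0) + if (x : ℤ) = -i then 1 else 0 : ℂ) =
          if |(x : ℤ)| = i then 1 else 0 := by
      rw [Finset.mem_Icc] at hi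
      rcases abs_cases (x : ℤ) with h | h <;> split_ifs <;> first | omega | simp
    rw [Finset.sum_congr rfl this, Finset.sum_ite_eq]
    simp [Finset.mem_Icc]
  · simp [Matrix.sum_apply, Emat_self_apply, hxy]

theorem trace_sum_Emat_pair {S : Finset ℤ} {a b : ℤ}
    (h : ∀ i ∈ Finset.Icc a b, i ∈ S ∧ -i ∈ S) :
    (∑ i ∈ Finset.Icc a b, (Emat S i i + Emat S (-i) (-i))).trace =
      2 * ((b + 1 - a).toNat : ℂ) := by
  rw [trace_sum, Finset.sum_congr rfl fun i hi => show _ = (2 : ℂ) by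
    rw [trace_add, trace_Emat_self (h i hi).1, trace_Emat_self (h i hi).2]; norm_num]
  simp [mul_comm]

theorem Kmat_kronecker_one (S : Finset ℤ) (c : ℂ) (M : Matrix (Idx S) (Idx S) ℂ) (w : ℂ) :
    Kmat S c M w ⊗ₖ (1 : Matrix (Idx S) (Idx S) ℂ) =
      (1 - c * w)⁻¹ • (1 - (c * w) • (M ⊗ₖ 1)) := by
  rw [Kmat, smul_kronecker]
  congr 1
  rw [eq_sub_iff_add_eq, ← smul_kronecker, ← add_kronecker, sub_add_cancel, one_kronecker_one]

theorem one_kronecker_Kmat (S : Finset ℤ) (c : ℂ) (M : Matrix (Idx S) (Idx S) ℂ) (w : ℂ) :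
    (1 : Matrix (Idx S) (Idx S) ℂ) ⊗ₖ Kmat S c M w =
      (1 - c * w)⁻¹ • (1 - (c * w) • (1 ⊗ₖ M)) := by
  rw [Kmat, kronecker_smul]
  congr 1
  rw [eq_sub_iff_add_eq, ← kronecker_smul, ← kronecker_add, sub_add_cancel, one_kronecker_one]

/-- the K-matrix `K(u) = (I - c·u·𝒢)(1 - c·u)⁻¹`, `c = 4/(p-q)`, of type CII
(symmetric pair `(sp_N, sp_p ⊕ sp_q)`, `p, q` even, `p > q > 0`, `p + q = N = 2n`) solves
the reflection equation for the symplectic R-matrix (`κ = N/2 + 1`). -/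
theorem reflection_CII (N n p q : ℕ) (hp : Even p) (hqe : Even q)
    (hq : 0 < q) (hpq : q < p) (hsum : p + q = N) (hpar : N = 2 * n)
    (S : Finset ℤ) (hS : S = (Finset.Icc (-(n : ℤ)) (n : ℤ)).erase 0)
    (κ : ℂ) (hκ : κ = (N : ℂ) / 2 + 1)
    (c : ℂ) (hc : c = 4 / ((p : ℂ) - (q : ℂ)))
    (G : Matrix (Idx S) (Idx S) ℂ)
    (hG : G = -(∑ i ∈ Finset.Icc (1 : ℤ) ((q : ℤ) / 2), (Emat S i i + Emat S (-i) (-i)))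
            + ∑ i ∈ Finset.Icc (((q : ℤ) / 2) + 1) ((N : ℤ) / 2),
                (Emat S i i + Emat S (-i) (-i)))
    (u v : ℂ) (h1 : u - v ≠ 0) (h2 : u - v ≠ κ) (h3 : u + v ≠ 0) (h4 : u + v ≠ κ)
    (h5 : c * u ≠ 1) (h6 : c * v ≠ 1) :
    Rmat S θsymp κ (u - v) * (Kmat S c G u ⊗ₖ (1 : Matrix (Idx S) (Idx S) ℂ)) *
        Rmat S θsymp κ (u + v) * ((1 : Matrix (Idx S) (Idx S) ℂ) ⊗ₖ Kmat S c G v) =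
      ((1 : Matrix (Idx S) (Idx S) ℂ) ⊗ₖ Kmat S c G v) * Rmat S θsymp κ (u + v) *
        (Kmat S c G u ⊗ₖ (1 : Matrix (Idx S) (Idx S) ℂ)) * Rmat S θsymp κ (u - v) := by
  have h0 : (0 : ℤ) ∉ S := by simp [hS]
  have hmem (i : ℤ) : i ∈ S ↔ i ≠ 0 ∧ -(n : ℤ) ≤ i ∧ i ≤ n := by simp [hS]
  have hneg (i : ℤ) (hi : i ∈ S) : -i ∈ S := by rw [hmem] at hi ⊢; omega
  have hcard : #S = N := by
    rw [hS, Finset.card_erase_of_mem (by simp), Int.card_Icc]; omega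
  have hN2 : (N : ℤ) / 2 = n := by omega
  obtain ⟨m, hm⟩ := hqe
  have hq2 : (q : ℤ) / 2 = m := by omega
  rw [hN2, hq2] at hG
  have hmn : m < n := by omega
  have htr : G.trace = (p : ℂ) - q := by
    rw [hG, trace_add, trace_neg,
      trace_sum_Emat_pair fun i hi => by simp only [hmem, Finset.mem_Icc] at hi ⊢; omega,
      trace_sum_Emat_pair fun i hi => by simp only [hmem, Finset.mem_Icc] at hi ⊢; omega]
    have e1 : ((m : ℤ) + 1 - 1).toNat = m := by omega
    have e2 : ((n : ℤ) + 1 - (m + 1)).toNat = n - m := by omega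
    have hp' : p = 2 * n - 2 * m := by omega
    have hp'' : (p : ℂ) = 2 * n - 2 * m := by
      rw [hp', Nat.cast_sub (by omega)]; push_cast; ring
    rw [e1, e2, Nat.cast_sub hmn.le, hp'', hm]
    push_cast
    ring
  obtain ⟨g, hgneg, hgsq, rfl⟩ : ∃ g : ℤ → ℂ, (∀ i, g (-i) = g i) ∧ (∀ i, g i * g i = 1) ∧
      G = diagonal fun x : Idx S => g x := by
    refine ⟨fun i => if |i| ≤ m then -1 else 1, fun i => by simp [abs_neg], fun i => by
      dsimp only; split_ifs <;> simp, ?_⟩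
    rw [hG, sum_Emat_pair S one_pos, sum_Emat_pair S (by omega), diagonal_neg, diagonal_add]
    congr 1
    ext ⟨i, hi⟩
    rw [hmem] at hi
    dsimp only
    rcases abs_cases i with h | h <;> split_ifs <;> first | omega | simp
  have hGG : (diagonal fun x : Idx S => g x) * (diagonal fun x : Idx S => g x) = 1 := by
    rw [diagonal_mul_diagonal, ← diagonal_one]
    simp only [hgsq]
  have ht : (p : ℂ) - q ≠ 0 := sub_ne_zero.2 (by exact_mod_cast hpq.ne')
  have main := reflection_of_relations_s5 (Pmat_mul_self S) (Pmat_mul_Qmat h0) (Qmat_mul_Pmat h0)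
    (Qmat_mul_self hneg)
    (by rw [← mul_kronecker_mul, hGG, one_mul, one_kronecker_one])
    (by rw [← mul_kronecker_mul, hGG, one_mul, one_kronecker_one])
    (by rw [← mul_kronecker_mul, ← mul_kronecker_mul]; simp only [one_mul, mul_one])
    (Pmat_mul_kronecker_one S _) (Pmat_mul_one_kronecker S _)
    (one_kronecker_diagonal_mul_Qmat hgneg) (Qmat_mul_one_kronecker_diagonal hgneg)
    (htr ▸ Qmat_mul_diagonal_kronecker_one_mul_Qmat hneg _) ht (hcard ▸ hκ) hc h1 h2 h3 h4
  simp only [Kmat_kronecker_one, one_kronecker_Kmat, Rmat, smul_mul_assoc, mul_smul_comm, main]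
  rw [smul_comm]
end
end
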